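/- In the massive-photon setup, assume g·sin θ ≠ 0 and assume relation (repr-f') holds: ∑_c ( (f' d c a)·(f' c e b) − (f' d c b)·(f' c e a) ) = −∑_c (f a b c)·(f' d e c) for all a, b, d, e ∈ Fin 4. Then a contradiction follows (False). (One cannot give the photon a small non-zero mass: if all four masses are non-zero, the consistency conditions of second-order gauge invariance are violated; at least one of the masses m 0, m 1, m 2 must vanish.) -/

import Mathlib

/-- With `x`, `y`, `z` the squared sides of a triangle, the hypotheses say that the cosine of the
angle opposite `x` times either of the other two cosines equals the remaining one. -/
lemma false_of_cosine_relations {x y z : ℝ} (hx : x ≠ 0) (hy : y ≠ 0) (hz : z ≠ 0)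
    (h₁ : (y + z - x) * (z + x - y) = 2 * z * (y + x - z))
    (h₂ : (y + x - z) * (z + y - x) = 2 * y * (z + x - y)) : False := by
  have hYZ : (z + x - y) * (y + x - z) = 0 := by linarith
  rcases mul_eq_zero.mp hYZ with h | h
  · rw [h, mul_zero] at h₁
    exact mul_ne_zero (mul_ne_zero two_ne_zero hz)
      (by intro h0; exact hx (by linarith)) h₁.symm
  · rw [h, zero_mul] at h₂
    exact mul_ne_zero (mul_ne_zero two_ne_zero hy)
      (by intro h0; exact hx (by linarith)) h₂.symm

/-- One cannot give the photon a small non-zero mass: if all four masses are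
non-zero, the consistency conditions of second-order gauge invariance
(relation (repr-f')) lead to a contradiction. -/
theorem stmt_14 (θ g : ℝ) (hgs : g * Real.sin θ ≠ 0)
    (m : Fin 4 → ℝ) (hm : ∀ a, m a ≠ 0)
    (f : Fin 4 → Fin 4 → Fin 4 → ℝ)
    (hf1 : ∀ a b c, f a b c = -f b a c) (hf2 : ∀ a b c, f a b c = -f a c b)
    (hf210 : f 2 1 0 = g * Real.sin θ) (hf321 : f 3 2 1 = g * Real.cos θ)
    (hf310 : f 3 1 0 = 0) (hf320 : f 3 2 0 = 0)
    (hfsupp : ∀ a b c : Fin 4, ({a, b, c} : Finset (Fin 4)) ≠ {0, 1, 2} →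
      ({a, b, c} : Finset (Fin 4)) ≠ {1, 2, 3} → f a b c = 0)
    (f' : Fin 4 → Fin 4 → Fin 4 → ℝ)
    (hf'def : ∀ a b c, f' a b c =
      ((m a) ^ 2 + (m b) ^ 2 - (m c) ^ 2) / (2 * m a * m b) * f a b c)
    (hrepr : ∀ a b d e : Fin 4, (∑ c, (f' d c a * f' c e b - f' d c b * f' c e a))
      = -∑ c, f a b c * f' d e c) :
    False := by
  have hswap : ∀ a b, f a a b = 0 := fun a b => by linarith [hf1 a a b]
  have hdiag : ∀ a b, f a b b = 0 := fun a b => by linarith [hf2 a b b]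
  have hdiag' : ∀ a b, f a b a = 0 := fun a b => by rw [hf2, hswap, neg_zero]
  have h201 : f 2 0 1 = -(g * Real.sin θ) := by rw [hf2, hf210]
  have h120 : f 1 2 0 = -(g * Real.sin θ) := by rw [hf1, hf210]
  have h102 : f 1 0 2 = g * Real.sin θ := by rw [hf2, h120, neg_neg]
  have h021 : f 0 2 1 = g * Real.sin θ := by rw [hf1, h201, neg_neg]
  have h012 : f 0 1 2 = -(g * Real.sin θ) := by rw [hf2, h021]
  have h130 : f 1 3 0 = 0 := by rw [hf1, hf310, neg_zero]
  have h230 : f 2 3 0 = 0 := by rw [hf1, hf320, neg_zero]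
  have h013 : f 0 1 3 = 0 := by rw [hf1, hf2, h130, neg_zero, neg_zero]
  have h023 : f 0 2 3 = 0 := by rw [hf1, hf2, h230, neg_zero, neg_zero]
  have e1 := hrepr 0 1 1 0
  have e2 := hrepr 0 2 2 0
  simp only [Fin.sum_univ_four, hf'def, hswap, hdiag, hdiag', hf210, h201, h120, h102, h021, h012,
    h130, h230, h013, h023, mul_zero, zero_mul, sub_zero, add_zero, zero_add] at e1 e2
  have m0 := hm 0
  have m1 := hm 1
  have m2 := hm 2
  generalize g * Real.sin θ = s at *
  field_simp at e1 e2
  exact false_of_cosine_relations (pow_ne_zero 2 m0) (pow_ne_zero 2 m1) (pow_ne_zero 2 m2)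
    (by linarith) (by linarith)
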